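/- Let Γ be a groupoid and R an object unital Γ-graded ring. Then R is a Γ-graded division ring if and only if R is a pfm ring that has invariant pseudo-basis number (IPBN). -/

import Mathlib

set_option autoImplicit false

noncomputable section

universe u v w x y

/-- A groupoid structure on its set `Γ` of morphisms.  Objects are identified with
the identity morphisms: `src γ` and `tgt γ` are the source and target identities
(`d(γ)` and `r(γ)`), and `comp γ δ h` is the composite `γδ`, which is defined
exactly when `src γ = tgt δ`. -/
structure Gpd (Γ : Type u) where
  src : Γ → Γ
  tgt : Γ → Γ
  inv : Γ → Γ
  comp : (γ δ : Γ) → src γ = tgt δ → Γ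
  src_src : ∀ γ, src (src γ) = src γ
  tgt_src : ∀ γ, tgt (src γ) = src γ
  src_tgt : ∀ γ, src (tgt γ) = tgt γ
  tgt_tgt : ∀ γ, tgt (tgt γ) = tgt γ
  src_comp : ∀ γ δ (h : src γ = tgt δ), src (comp γ δ h) = src δ
  tgt_comp : ∀ γ δ (h : src γ = tgt δ), tgt (comp γ δ h) = tgt γ
  comp_id : ∀ γ, comp γ (src γ) (tgt_src γ).symm = γ
  id_comp : ∀ γ, comp (tgt γ) γ (src_tgt γ) = γ
  comp_assoc : ∀ γ δ ε (h₁ : src γ = tgt δ) (h₂ : src δ = tgt ε),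
    comp (comp γ δ h₁) ε ((src_comp γ δ h₁).trans h₂)
      = comp γ (comp δ ε h₂) (h₁.trans (tgt_comp δ ε h₂).symm)
  src_inv : ∀ γ, src (inv γ) = tgt γ
  tgt_inv : ∀ γ, tgt (inv γ) = src γ
  inv_inv : ∀ γ, inv (inv γ) = γ
  comp_inv : ∀ γ, comp γ (inv γ) (tgt_inv γ).symm = tgt γ
  inv_comp : ∀ γ, comp (inv γ) γ (src_inv γ) = src γ

namespace Gpd

variable {Γ : Type u} (G : Gpd Γ)

/-- `e` is an object of the groupoid, i.e. an identity morphism. -/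
def IsObj (e : Γ) : Prop := G.src e = e

open scoped Classical in
/-- Partial composition: `some (γδ)` when defined, `none` otherwise. -/
def mul? (γ δ : Γ) : Option Γ :=
  if h : G.src γ = G.tgt δ then some (G.comp γ δ h) else none

/-- The partial triple product `σ γ τ⁻¹`, `none` when undefined. -/
def conj? (σ γ τ : Γ) : Option Γ :=
  (G.mul? σ γ).bind fun η => G.mul? η (G.inv τ)

end Gpd

/-- An object unital `Γ`-graded ring structure on the (possibly non-unital) ring `R`:
a decomposition `R = ⊕ R_γ` with `R_γ R_δ ⊆ R_{γδ}` (zero when `γδ` is undefined),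
together with local units `1_e ∈ R_e` for the objects `e` such that
`1_{r(γ)} a = a 1_{d(γ)} = a` for homogeneous `a` of degree `γ`. -/
structure GammaRing {Γ : Type u} (G : Gpd Γ) (R : Type v) [NonUnitalRing R] where
  grade : Γ → AddSubgroup R
  grade_iSup : (⨆ γ : Γ, grade γ) = ⊤
  grade_indep : ∀ γ : Γ, grade γ ⊓ (⨆ (δ : Γ) (_ : δ ≠ γ), grade δ) = ⊥
  mul_mem : ∀ (γ δ : Γ) (h : G.src γ = G.tgt δ) (a b : R),
    a ∈ grade γ → b ∈ grade δ → a * b ∈ grade (G.comp γ δ h)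
  mul_ne : ∀ (γ δ : Γ), G.src γ ≠ G.tgt δ → ∀ (a b : R),
    a ∈ grade γ → b ∈ grade δ → a * b = 0
  one : Γ → R
  one_mem : ∀ e : Γ, G.IsObj e → one e ∈ grade e
  one_mul' : ∀ (γ : Γ) (a : R), a ∈ grade γ → one (G.tgt γ) * a = a
  mul_one' : ∀ (γ : Γ) (a : R), a ∈ grade γ → a * one (G.src γ) = a

/-- A (unital) `Γ`-graded right module over the object unital `Γ`-graded ring `RG`. -/
structure GammaMod {Γ : Type u} {G : Gpd Γ} {R : Type v} [NonUnitalRing R]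
    (RG : GammaRing G R) (M : Type w) [AddCommGroup M] where
  smul : M → R → M
  smul_add : ∀ (m : M) (a b : R), smul m (a + b) = smul m a + smul m b
  add_smul : ∀ (m n : M) (a : R), smul (m + n) a = smul m a + smul n a
  smul_mul : ∀ (m : M) (a b : R), smul m (a * b) = smul (smul m a) b
  grade : Γ → AddSubgroup M
  grade_iSup : (⨆ γ : Γ, grade γ) = ⊤
  grade_indep : ∀ γ : Γ, grade γ ⊓ (⨆ (δ : Γ) (_ : δ ≠ γ), grade δ) = ⊥
  smul_mem : ∀ (σ τ : Γ) (h : G.src σ = G.tgt τ) (m : M) (a : R),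
    m ∈ grade σ → a ∈ RG.grade τ → smul m a ∈ grade (G.comp σ τ h)
  smul_ne : ∀ (σ τ : Γ), G.src σ ≠ G.tgt τ → ∀ (m : M) (a : R),
    m ∈ grade σ → a ∈ RG.grade τ → smul m a = 0
  smul_one : ∀ (σ : Γ) (m : M), m ∈ grade σ → smul m (RG.one (G.src σ)) = m

/-- A (unital) `Γ`-graded left module over the object unital `Γ`-graded ring `RG`. -/
structure GammaLMod {Γ : Type u} {G : Gpd Γ} {R : Type v} [NonUnitalRing R]
    (RG : GammaRing G R) (M : Type w) [AddCommGroup M] where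
  smul : R → M → M
  smul_add : ∀ (a : R) (m n : M), smul a (m + n) = smul a m + smul a n
  add_smul : ∀ (a b : R) (m : M), smul (a + b) m = smul a m + smul b m
  mul_smul : ∀ (a b : R) (m : M), smul (a * b) m = smul a (smul b m)
  grade : Γ → AddSubgroup M
  grade_iSup : (⨆ γ : Γ, grade γ) = ⊤
  grade_indep : ∀ γ : Γ, grade γ ⊓ (⨆ (δ : Γ) (_ : δ ≠ γ), grade δ) = ⊥
  smul_mem : ∀ (τ σ : Γ) (h : G.src τ = G.tgt σ) (a : R) (m : M),
    a ∈ RG.grade τ → m ∈ grade σ → smul a m ∈ grade (G.comp τ σ h)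
  smul_ne : ∀ (τ σ : Γ), G.src τ ≠ G.tgt σ → ∀ (a : R) (m : M),
    a ∈ RG.grade τ → m ∈ grade σ → smul a m = 0
  one_smul : ∀ (σ : Γ) (m : M), m ∈ grade σ → smul (RG.one (G.tgt σ)) m = m

namespace GammaMod

variable {Γ : Type u} {G : Gpd Γ} {R : Type v} [NonUnitalRing R] {RG : GammaRing G R}
  {M : Type w} [AddCommGroup M] (Mod : GammaMod RG M)

/-- `shiftGrade σ γ` is the homogeneous component `M_{σγ}` (zero when undefined):
the degree-`γ` component of the shifted module `M(σ)`. -/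
def shiftGrade (σ γ : Γ) : AddSubgroup M := (G.mul? σ γ).elim ⊥ Mod.grade

/-- `N` is a graded submodule of `M`. -/
def IsGradedSub (N : AddSubgroup M) : Prop :=
  (∀ m ∈ N, ∀ a : R, Mod.smul m a ∈ N) ∧ N ≤ ⨆ γ : Γ, (Mod.grade γ ⊓ N)

/-- `N` is a gr-simple graded submodule of `M`. -/
def IsGrSimpleSub (N : AddSubgroup M) : Prop :=
  Mod.IsGradedSub N ∧ N ≠ ⊥ ∧
    ∀ P : AddSubgroup M, Mod.IsGradedSub P → P ≤ N → P = ⊥ ∨ P = N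

/-- `M` is a gr-simple graded module. -/
def IsGrSimple : Prop := Mod.IsGrSimpleSub ⊤

/-- `M` is a gr-semisimple graded module: it is the sum of its gr-simple graded
submodules. -/
def IsGrSemisimple : Prop :=
  (⨆ (N : AddSubgroup M) (_ : Mod.IsGrSimpleSub N), N) = ⊤

/-- The submodule `M(e) = ⊕_{r(γ) = e} M_γ`. -/
def eComp (e : Γ) : AddSubgroup M := ⨆ (γ : Γ) (_ : G.tgt γ = e), Mod.grade γ

/-- `M` is `Γ₀`-artinian: each `M(e)` satisfies the descending chain condition on
graded submodules. -/
def IsGamma0Artinian : Prop :=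
  ∀ e : Γ, G.IsObj e → ∀ f : ℕ → AddSubgroup M,
    (∀ n, Mod.IsGradedSub (f n) ∧ f n ≤ Mod.eComp e) →
    (∀ n, f (n + 1) ≤ f n) → ∃ n, ∀ k, n ≤ k → f k = f n

/-- `M` is a (nonzero) `Γ₀`-simple module: `M(e)` is gr-simple for every `e ∈ Γ'₀(M)`. -/
def IsGamma0Simple : Prop :=
  (∃ m : M, m ≠ 0) ∧
    ∀ e : Γ, G.IsObj e → Mod.eComp e ≠ ⊥ → Mod.IsGrSimpleSub (Mod.eComp e)

theorem isGradedSub_top : Mod.IsGradedSub (⊤ : AddSubgroup M) := by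
  constructor
  · intro m _ a
    exact AddSubgroup.mem_top _
  · have h : (⨆ γ : Γ, (Mod.grade γ ⊓ (⊤ : AddSubgroup M))) = (⊤ : AddSubgroup M) := by
      simp [Mod.grade_iSup]
    rw [h]

/-- `HomGrade γ` is the homogeneous component `HOM_R(M,M)_γ` of the graded
endomorphism ring `END_R(M)`: the `R`-linear additive endomorphisms `g` with
`g(M_σ) ⊆ M_{γσ}` for all `σ`. -/
def HomGrade (γ : Γ) : Set (M →+ M) :=
  {g | (∀ (m : M) (a : R), g (Mod.smul m a) = Mod.smul (g m) a) ∧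
       ∀ (σ : Γ) (m : M), m ∈ Mod.grade σ → g m ∈ Mod.shiftGrade γ σ}

/-- The graded submodule `N` of `M` is gr-isomorphic to a shift of the graded
submodule `N'` of `M₂`: there are `σ ∈ Γ` and a gr-isomorphism `N ≅ N'(σ)`. -/
def SubIso {M₂ : Type x} [AddCommGroup M₂] (Mod₂ : GammaMod RG M₂)
    (N : AddSubgroup M) (N' : AddSubgroup M₂) (hN : Mod.IsGradedSub N) : Prop :=
  ∃ (σ : Γ) (ψ : N ≃+ N'),
    (∀ (n : N) (a : R),
      ((ψ ⟨Mod.smul n.1 a, hN.1 n.1 n.2 a⟩ : N') : M₂) = Mod₂.smul ((ψ n : N') : M₂) a) ∧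
    ∀ γ : Γ, (fun n : N => ((ψ n : N') : M₂)) '' {n : N | (n : M) ∈ Mod.grade γ}
      = {m : M₂ | m ∈ N' ∧ m ∈ Mod₂.shiftGrade σ γ}

variable {ι : Type y}

/-- A pseudo-linearly independent sequence of homogeneous elements. -/
def PseudoLI (β : ι → Γ) (v : ι → M) : Prop :=
  (∀ i, v i ∈ Mod.grade (β i) ∧ v i ≠ 0) ∧
  ∀ a : ι →₀ R, (∀ i, RG.one (G.src (β i)) * a i = a i) →
    (a.sum fun i r => Mod.smul (v i) r) = 0 → a = 0

/-- A pseudo-basis of `M`: a generating pseudo-linearly independent sequence of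
homogeneous elements. -/
def PseudoBasis (β : ι → Γ) (v : ι → M) : Prop :=
  Mod.PseudoLI β v ∧
    AddSubgroup.closure {m : M | ∃ (i : ι) (r : R), m = Mod.smul (v i) r} = ⊤

/-- `M` is pseudo-free: it has a pseudo-basis. -/
def PseudoFree : Prop :=
  ∃ (κ : Type (max u w)) (β : κ → Γ) (v : κ → M), Mod.PseudoBasis β v

end GammaMod

namespace GammaLMod

variable {Γ : Type u} {G : Gpd Γ} {R : Type v} [NonUnitalRing R] {RG : GammaRing G R}
  {M : Type w} [AddCommGroup M] (Mod : GammaLMod RG M)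

/-- `rshiftGrade σ γ` is the homogeneous component `M_{σγ}` (zero when undefined). -/
def rshiftGrade (σ γ : Γ) : AddSubgroup M := (G.mul? σ γ).elim ⊥ Mod.grade

/-- `N` is a graded left submodule of `M`. -/
def IsGradedSub (N : AddSubgroup M) : Prop :=
  (∀ m ∈ N, ∀ a : R, Mod.smul a m ∈ N) ∧ N ≤ ⨆ γ : Γ, (Mod.grade γ ⊓ N)

def IsGrSimpleSub (N : AddSubgroup M) : Prop :=
  Mod.IsGradedSub N ∧ N ≠ ⊥ ∧
    ∀ P : AddSubgroup M, Mod.IsGradedSub P → P ≤ N → P = ⊥ ∨ P = N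

def IsGrSimple : Prop := Mod.IsGrSimpleSub ⊤

def IsGrSemisimple : Prop :=
  (⨆ (N : AddSubgroup M) (_ : Mod.IsGrSimpleSub N), N) = ⊤

/-- The left submodule `(e)M = ⊕_{d(γ) = e} M_γ`. -/
def lComp (e : Γ) : AddSubgroup M := ⨆ (γ : Γ) (_ : G.src γ = e), Mod.grade γ

def IsGamma0Artinian : Prop :=
  ∀ e : Γ, G.IsObj e → ∀ f : ℕ → AddSubgroup M,
    (∀ n, Mod.IsGradedSub (f n) ∧ f n ≤ Mod.lComp e) →
    (∀ n, f (n + 1) ≤ f n) → ∃ n, ∀ k, n ≤ k → f k = f n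

/-- `V` has finite `Γ₀`-dimension: each `(e)V` has a finite pseudo-basis. -/
def FiniteGamma0Dim : Prop :=
  ∀ e : Γ, G.IsObj e → ∃ (n : ℕ) (γs : Fin n → Γ) (u : Fin n → M),
    (∀ i, G.src (γs i) = e ∧ u i ∈ Mod.grade (γs i) ∧ u i ≠ 0) ∧
    (∀ m ∈ Mod.lComp e,
      m ∈ AddSubgroup.closure {y : M | ∃ (i : Fin n) (a : R), y = Mod.smul a (u i)}) ∧
    ∀ a : Fin n → R, (∀ i, a i * RG.one (G.tgt (γs i)) = a i) →
      (∑ i, Mod.smul (a i) (u i)) = 0 → ∀ i, a i = 0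

end GammaLMod

namespace GammaRing

variable {Γ : Type u} {G : Gpd Γ} {R : Type v} [NonUnitalRing R] (RG : GammaRing G R)

/-- The (right) regular graded module `R_R`. -/
def regular : GammaMod RG R where
  smul := fun m a => m * a
  smul_add := fun m a b => mul_add m a b
  add_smul := fun m n a => add_mul m n a
  smul_mul := fun m a b => (mul_assoc m a b).symm
  grade := RG.grade
  grade_iSup := RG.grade_iSup
  grade_indep := RG.grade_indep
  smul_mem := RG.mul_mem
  smul_ne := RG.mul_ne
  smul_one := RG.mul_one'

/-- The left regular graded module `_R R`. -/
def leftRegular : GammaLMod RG R where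
  smul := fun a m => a * m
  smul_add := fun a m n => mul_add a m n
  add_smul := fun a b m => add_mul a b m
  mul_smul := fun a b m => mul_assoc a b m
  grade := RG.grade
  grade_iSup := RG.grade_iSup
  grade_indep := RG.grade_indep
  smul_mem := RG.mul_mem
  smul_ne := RG.mul_ne
  one_smul := RG.one_mul'

/-- `I` is a graded (two-sided) ideal of `R`. -/
def IsGradedIdeal (I : AddSubgroup R) : Prop :=
  (∀ a ∈ I, ∀ r : R, a * r ∈ I ∧ r * a ∈ I) ∧ I ≤ ⨆ γ : Γ, (RG.grade γ ⊓ I)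

/-- `R` is a gr-simple ring. -/
def IsGrSimpleRing : Prop :=
  (∃ a : R, a ≠ 0) ∧ ∀ I : AddSubgroup R, RG.IsGradedIdeal I → I = ⊥ ∨ I = ⊤

/-- `R` is a gr-prime ring. -/
def IsGrPrime : Prop :=
  (∃ a : R, a ≠ 0) ∧ ∀ I J : AddSubgroup R, RG.IsGradedIdeal I → RG.IsGradedIdeal J →
    I ≠ ⊥ → J ≠ ⊥ → ∃ a ∈ I, ∃ b ∈ J, a * b ≠ 0

/-- `R` is a `Γ`-graded division ring: `R ≠ 0` and every nonzero homogeneous element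
of degree `γ` has an inverse of degree `γ⁻¹`. -/
def IsGrDivision : Prop :=
  (∃ a : R, a ≠ 0) ∧ ∀ (γ : Γ) (a : R), a ∈ RG.grade γ → a ≠ 0 →
    ∃ b ∈ RG.grade (G.inv γ), a * b = RG.one (G.tgt γ) ∧ b * a = RG.one (G.src γ)

/-- `supp(R) ⊆ eΓe`. -/
def SuppLE (e : Γ) : Prop := ∀ γ : Γ, RG.grade γ ≠ ⊥ → G.src γ = e ∧ G.tgt γ = e

def IsRightGrSemisimple : Prop := RG.regular.IsGrSemisimple

def IsLeftGrSemisimple : Prop := RG.leftRegular.IsGrSemisimple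

def IsRightGamma0Artinian : Prop := RG.regular.IsGamma0Artinian

def IsLeftGamma0Artinian : Prop := RG.leftRegular.IsGamma0Artinian

/-- The component ring `R_e` is a division ring with identity `1_e`. -/
def ComponentDivisionRing (e : Γ) : Prop :=
  RG.one e ≠ 0 ∧ ∀ a ∈ RG.grade e, a ≠ 0 →
    ∃ b ∈ RG.grade e, a * b = RG.one e ∧ b * a = RG.one e

/-- The additive subgroup `N` of `R` is, with the induced structure, a gr-simple
graded ring. -/
def SubringGrSimple (N : AddSubgroup R) : Prop :=
  N ≠ ⊥ ∧ ∀ P : AddSubgroup R,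
    (P ≤ N ∧ (∀ p ∈ P, ∀ n ∈ N, p * n ∈ P ∧ n * p ∈ P) ∧
      P ≤ ⨆ γ : Γ, (RG.grade γ ⊓ P)) →
    P = ⊥ ∨ P = N

/-- The additive subgroup `N` of `R` is, with the induced structure, a gr-prime
graded ring. -/
def SubringGrPrime (N : AddSubgroup R) : Prop :=
  (∃ a ∈ N, a ≠ 0) ∧ ∀ P Q : AddSubgroup R,
    (P ≤ N ∧ (∀ p ∈ P, ∀ n ∈ N, p * n ∈ P ∧ n * p ∈ P) ∧
      P ≤ ⨆ γ : Γ, (RG.grade γ ⊓ P)) →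
    (Q ≤ N ∧ (∀ q ∈ Q, ∀ n ∈ N, q * n ∈ Q ∧ n * q ∈ Q) ∧
      Q ≤ ⨆ γ : Γ, (RG.grade γ ⊓ Q)) →
    P ≠ ⊥ → Q ≠ ⊥ → ∃ p ∈ P, ∃ q ∈ Q, p * q ≠ 0

/-- The additive subgroup `N` of `R` is, with the induced structure, a graded
division ring. -/
def SubringGrDivision (N : AddSubgroup R) : Prop :=
  (∃ a ∈ N, a ≠ 0) ∧ ∀ (γ : Γ) (a : R), a ∈ RG.grade γ → a ∈ N → a ≠ 0 →
    RG.one (G.tgt γ) ∈ N ∧ RG.one (G.src γ) ∈ N ∧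
    ∃ b ∈ RG.grade (G.inv γ), b ∈ N ∧ a * b = RG.one (G.tgt γ) ∧ b * a = RG.one (G.src γ)

/-- The additive subgroup `N` of `R` is, with the induced structure, a right
`Γ₀`-artinian graded ring. -/
def SubringRightGamma0Artinian (N : AddSubgroup R) : Prop :=
  ∀ e : Γ, G.IsObj e → ∀ f : ℕ → AddSubgroup R,
    (∀ n, f n ≤ N ⊓ RG.regular.eComp e ∧ (∀ p ∈ f n, ∀ x ∈ N, p * x ∈ f n) ∧
      f n ≤ ⨆ γ : Γ, (RG.grade γ ⊓ f n)) →
    (∀ n, f (n + 1) ≤ f n) → ∃ n, ∀ k, n ≤ k → f k = f n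

end GammaRing

/-- A bundled object unital `Γ`-graded ring. -/
structure BRing.{u', v'} {Γ : Type u'} (G : Gpd Γ) where
  carrier : Type v'
  [ring : NonUnitalRing carrier]
  str : GammaRing G carrier

attribute [instance] BRing.ring

/-- A bundled `Γ`-graded right module over `RG`. -/
structure BMod.{u', v', w'} {Γ : Type u'} {G : Gpd Γ} {R : Type v'} [NonUnitalRing R]
    (RG : GammaRing G R) where
  carrier : Type w'
  [acg : AddCommGroup carrier]
  str : GammaMod RG carrier

attribute [instance] BMod.acg

/-- Two bundled graded modules are in the same isoshift class. -/
def BModSameClass {Γ : Type u} {G : Gpd Γ} {R : Type v} [NonUnitalRing R]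
    {RG : GammaRing G R} (S T : BMod.{u, v, w} RG) : Prop :=
  S.str.SubIso T.str ⊤ ⊤ S.str.isGradedSub_top

/-- The isoshiftical component of `R` of the type of the graded module `S`:
the sum of all graded right ideals of `R` which are gr-simple and lie in the
isoshift class of `S`. -/
def GammaRing.isoComponent {Γ : Type u} {G : Gpd Γ} {R : Type v} [NonUnitalRing R]
    (RG : GammaRing G R) (S : BMod.{u, v, w} RG) : AddSubgroup R :=
  ⨆ (N : AddSubgroup R) (_ : RG.regular.IsGrSimpleSub N ∧
      ∃ hN : RG.regular.IsGradedSub N, RG.regular.SubIso S.str N ⊤ hN), N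

/-- `R` is a pseudo-free module ring: every `Γ`-graded right `R`-module is
pseudo-free. -/
def GammaRing.IsPfm.{u', v', w'} {Γ : Type u'} {G : Gpd Γ} {R : Type v'}
    [NonUnitalRing R] (RG : GammaRing G R) : Prop :=
  ∀ S : BMod.{u', v', w'} RG, S.str.PseudoFree

/-- `R` has invariant pseudo-basis number: any two pseudo-bases of a finitely
generated pseudo-free graded module have the same number of elements. -/
def GammaRing.IPBN.{u', v', w'} {Γ : Type u'} {G : Gpd Γ} {R : Type v'}
    [NonUnitalRing R] (RG : GammaRing G R) : Prop :=
  ∀ (S : BMod.{u', v', w'} RG) (m n : ℕ) (β₁ : Fin m → Γ) (v₁ : Fin m → S.carrier)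
    (β₂ : Fin n → Γ) (v₂ : Fin n → S.carrier),
    S.str.PseudoBasis β₁ v₁ → S.str.PseudoBasis β₂ v₂ → m = n

/-- A `d`-finite sequence of elements of `eΓ`. -/
def DFiniteSeq {Γ : Type u} (G : Gpd Γ) {I : Type w} (e : Γ) (σ : I → Γ) : Prop :=
  (∀ i, G.tgt (σ i) = e) ∧ ∀ f : Γ, {i : I | G.src (σ i) = f}.Finite

/-- The degree-`γ` constraint on the `(i,j)` entry of a homogeneous matrix:
the component `D_{σ_i γ σ_j⁻¹}` (zero when the product is undefined). -/
def entryGrade {Γ : Type u} (G : Gpd Γ) {D : Type v} [NonUnitalRing D]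
    (DG : GammaRing G D) {I : Type w} (σ : I → Γ) (γ : Γ) (i j : I) : AddSubgroup D :=
  (G.conj? (σ i) γ (σ j)).elim ⊥ DG.grade

/-- The `(i,j)` entry of the product of two finitely supported matrices. -/
def matMulEntry {I : Type w} {D : Type v} [NonUnitalRing D]
    (A B : I →₀ I →₀ D) (i j : I) : D :=
  (A i).sum fun k a => a * B k j

/-- `R` is gr-isomorphic to the graded matrix ring `M_I(D)(σ̄)`: there is an
injective additive map from `R` to the finitely supported `I×I` matrices over `D`
which respects matrix multiplication and maps the homogeneous component `R_γ` onto
the set of homogeneous matrices of degree `γ`. -/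
def GammaRing.GrRepMatrix {Γ : Type u} {G : Gpd Γ} {R : Type v} {D : Type x}
    [NonUnitalRing R] [NonUnitalRing D] (RG : GammaRing G R) (DG : GammaRing G D)
    {I : Type w} (σ : I → Γ) : Prop :=
  ∃ φ : R →+ (I →₀ I →₀ D), Function.Injective φ ∧
    (∀ (a b : R) (i j : I), φ (a * b) i j = matMulEntry (φ a) (φ b) i j) ∧
    ∀ γ : Γ, (fun r : R => φ r) '' (RG.grade γ : Set R)
      = {m : I →₀ I →₀ D | ∀ i j : I, m i j ∈ entryGrade G DG σ γ i j}

/-- Entry constraint for matrix rings indexed by a sequence of subsets of `Γ`: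
the component `D_{Σ_i γ Σ_j⁻¹}`. -/
def entryGradeSet {Γ : Type u} (G : Gpd Γ) {D : Type v} [NonUnitalRing D]
    (DG : GammaRing G D) {I : Type w} (Sig : I → Set Γ) (γ : Γ) (i j : I) :
    AddSubgroup D :=
  ⨆ (σ : Γ) (_ : σ ∈ Sig i) (τ : Γ) (_ : τ ∈ Sig j), (G.conj? σ γ τ).elim ⊥ DG.grade

/-- `R` is gr-isomorphic to the graded matrix ring `M_I(D)(Σ̄)` for a sequence of
subsets `Σ̄`. -/
def GammaRing.GrRepMatrixSet {Γ : Type u} {G : Gpd Γ} {R : Type v} {D : Type x}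
    [NonUnitalRing R] [NonUnitalRing D] (RG : GammaRing G R) (DG : GammaRing G D)
    {I : Type w} (Sig : I → Set Γ) : Prop :=
  ∃ φ : R →+ (I →₀ I →₀ D), Function.Injective φ ∧
    (∀ (a b : R) (i j : I), φ (a * b) i j = matMulEntry (φ a) (φ b) i j) ∧
    ∀ γ : Γ, (fun r : R => φ r) '' (RG.grade γ : Set R)
      = {m : I →₀ I →₀ D | ∀ i j : I, m i j ∈ entryGradeSet G DG Sig γ i j}

/-- The family of graded rings `Rj` is summable. -/
def SummableFam {Γ : Type u} {G : Gpd Γ} {J : Type w} (Rj : J → BRing.{u, x} G) : Prop :=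
  ∀ e : Γ, G.IsObj e → {j : J | (Rj j).str.grade e ≠ ⊥}.Finite

/-- `P` (with projections `π`) is the graded direct product `∏^gr_j R_j`. -/
def IsGradedProductB {Γ : Type u} {G : Gpd Γ} {J : Type w} (Rj : J → BRing.{u, x} G)
    {P : Type v} [NonUnitalRing P] (PG : GammaRing G P)
    (π : ∀ j, P →+ (Rj j).carrier) : Prop :=
  (∀ (j : J) (a b : P), π j (a * b) = π j a * π j b) ∧
  (∀ (j : J) (e : Γ), G.IsObj e → π j (PG.one e) = (Rj j).str.one e) ∧
  ∀ (γ : Γ) (xs : ∀ j, (Rj j).carrier), (∀ j, xs j ∈ (Rj j).str.grade γ) →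
    ∃! p : P, p ∈ PG.grade γ ∧ ∀ j, π j p = xs j

/-- `R` and `S` are gr-isomorphic graded rings. -/
def GrIso {Γ : Type u} {G : Gpd Γ} {R : Type v} {S : Type x}
    [NonUnitalRing R] [NonUnitalRing S] (RG : GammaRing G R) (SG : GammaRing G S) :
    Prop :=
  ∃ φ : R ≃+ S, (∀ a b : R, φ (a * b) = φ a * φ b) ∧
    (∀ e : Γ, G.IsObj e → φ (RG.one e) = SG.one e) ∧
    ∀ γ : Γ, (fun a : R => φ a) '' (RG.grade γ : Set R) = (SG.grade γ : Set S)

/-- The gr-primality relation: `1_e D 1_f ≠ 0`. -/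
def GrPrimRel {Γ : Type u} (G : Gpd Γ) {D : Type v} [NonUnitalRing D]
    (DG : GammaRing G D) (e f : Γ) : Prop :=
  ∃ x : D, DG.one e * x * DG.one f ≠ 0

/-- The graded ideal `D_{[e]}` attached to the `∼`-class of `e`. -/
def ClassIdeal {Γ : Type u} (G : Gpd Γ) {D : Type v} [NonUnitalRing D]
    (DG : GammaRing G D) (e : Γ) : AddSubgroup D :=
  ⨆ (γ : Γ) (_ : GrPrimRel G DG (G.tgt γ) e ∧ GrPrimRel G DG (G.src γ) e), DG.grade γ

end
universe u v w x y

/-- The homogeneous projections attached to an internal direct sum decomposition. -/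
theorem exists_homogeneous_projections {ι : Type u} {M : Type w} [AddCommGroup M]
    (A : ι → AddSubgroup M) (htop : (⨆ i, A i) = ⊤)
    (hind : ∀ i, A i ⊓ (⨆ (j : ι) (_ : j ≠ i), A j) = ⊥) :
    ∃ p : ι → M →+ M, (∀ i x, p i x ∈ A i) ∧ (∀ i x, x ∈ A i → p i x = x) ∧
      (∀ i j x, i ≠ j → x ∈ A j → p i x = 0) ∧
      ∀ x, x ∈ AddSubgroup.closure (Set.range fun i => p i x) := by
  classical
  have hI : iSupIndep A := fun i => disjoint_iff.mpr (hind i)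
  have hsurj : Function.Surjective (DFinsupp.sumAddHom fun i => (A i).subtype) := by
    intro x
    have hx : x ∈ ⨆ i, A i := htop ▸ AddSubgroup.mem_top x
    refine AddSubgroup.iSup_induction A
      (C := fun x => ∃ y, DFinsupp.sumAddHom (fun i => (A i).subtype) y = x) hx
      (fun i x hx => ⟨DFinsupp.single i ⟨x, hx⟩, by simp⟩) ⟨0, map_zero _⟩ ?_
    rintro _ _ ⟨a, rfl⟩ ⟨b, rfl⟩
    exact ⟨a + b, map_add _ _ _⟩
  let e : (Π₀ i, A i) ≃+ M :=
    AddEquiv.ofBijective (DFinsupp.sumAddHom fun i => (A i).subtype)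
      ⟨hI.dfinsuppSumAddHom_injective, hsurj⟩
  have he : ∀ i x (hx : x ∈ A i), e.symm x = DFinsupp.single i ⟨x, hx⟩ := by
    intro i x hx
    rw [AddEquiv.symm_apply_eq]
    exact (DFinsupp.sumAddHom_single (fun i => (A i).subtype) i ⟨x, hx⟩).symm
  refine ⟨fun i => ((A i).subtype.comp (DFinsupp.evalAddMonoidHom i)).comp
    (e.symm : M →+ Π₀ i, A i), fun i x => (e.symm x i).2, fun i x hx => ?_,
    fun i j x hij hx => ?_, fun x => ?_⟩
  · change ((e.symm x i : A i) : M) = x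
    rw [he i x hx, DFinsupp.single_eq_same]
  · change ((e.symm x i : A i) : M) = 0
    rw [he j x hx, DFinsupp.single_eq_of_ne hij, ZeroMemClass.coe_zero]
  · have hs : ∀ f, e f = f.sum fun i y => (y : M) := DFinsupp.sumAddHom_apply _
    have hx : (e.symm x).sum (fun i y => (y : M)) = x := by
      rw [← hs, e.apply_symm_apply]
    have hmem : (e.symm x).sum (fun i y => (y : M)) ∈
        AddSubgroup.closure (Set.range fun i => ((e.symm x i : A i) : M)) :=
      AddSubgroup.sum_mem _ fun i _ => AddSubgroup.subset_closure (Set.mem_range_self i)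
    rw [hx] at hmem
    exact hmem

namespace Gpd

variable {Γ : Type u} (G : Gpd Γ)

theorem comp_left_cancel (σ γ δ : Γ) (hγ : G.src σ = G.tgt γ) (hδ : G.src σ = G.tgt δ)
    (h : G.comp σ γ hγ = G.comp σ δ hδ) : γ = δ := by
  have key : ∀ (γ : Γ) (hγ : G.src σ = G.tgt γ),
      G.comp (G.inv σ) (G.comp σ γ hγ) ((G.src_inv σ).trans (G.tgt_comp σ γ hγ).symm) = γ := by
    intro γ hγ
    rw [← G.comp_assoc (G.inv σ) σ γ (G.src_inv σ) hγ]
    simp only [G.inv_comp, hγ, G.id_comp]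
  have h₁ := key γ hγ
  simp only [h, key δ hδ] at h₁
  exact h₁.symm

end Gpd

namespace GammaMod

variable {Γ : Type u} {G : Gpd Γ} {R : Type v} [NonUnitalRing R] {RG : GammaRing G R}
  {M : Type w} [AddCommGroup M] (Mod : GammaMod RG M)

/-- Scalar multiplication as a biadditive map. -/
def smulHom : M →+ R →+ M :=
  AddMonoidHom.mk' (fun m => AddMonoidHom.mk' (Mod.smul m) (Mod.smul_add m)) fun m n => by
    ext a
    exact Mod.add_smul m n a

@[simp]
theorem smulHom_apply (m : M) (a : R) : Mod.smulHom m a = Mod.smul m a := rfl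

theorem smul_zero (m : M) : Mod.smul m 0 = 0 := map_zero (Mod.smulHom m)

theorem zero_smul (a : R) : Mod.smul 0 a = 0 := by
  rw [← smulHom_apply, map_zero, AddMonoidHom.zero_apply]

theorem smul_neg (m : M) (a : R) : Mod.smul m (-a) = -Mod.smul m a := map_neg (Mod.smulHom m) a

theorem neg_smul (m : M) (a : R) : Mod.smul (-m) a = -Mod.smul m a := by
  rw [← smulHom_apply, map_neg, AddMonoidHom.neg_apply, smulHom_apply]

/-- The projection of a graded module onto its component of degree `γ`. -/
noncomputable def proj : Γ → M →+ M :=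
  (exists_homogeneous_projections Mod.grade Mod.grade_iSup Mod.grade_indep).choose

theorem proj_mem (γ : Γ) (m : M) : Mod.proj γ m ∈ Mod.grade γ :=
  (exists_homogeneous_projections Mod.grade Mod.grade_iSup Mod.grade_indep).choose_spec.1 γ m

theorem proj_of_mem {γ : Γ} {m : M} (hm : m ∈ Mod.grade γ) : Mod.proj γ m = m :=
  (exists_homogeneous_projections Mod.grade Mod.grade_iSup Mod.grade_indep).choose_spec.2.1 γ m hm

theorem proj_of_mem_ne {γ δ : Γ} {m : M} (h : γ ≠ δ) (hm : m ∈ Mod.grade δ) :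
    Mod.proj γ m = 0 :=
  (exists_homogeneous_projections Mod.grade Mod.grade_iSup
    Mod.grade_indep).choose_spec.2.2.1 γ δ m h hm

theorem mem_of_proj_mem {N : AddSubgroup M} {m : M} (h : ∀ γ, Mod.proj γ m ∈ N) : m ∈ N := by
  have hm := (exists_homogeneous_projections Mod.grade Mod.grade_iSup
    Mod.grade_indep).choose_spec.2.2.2 m
  refine (AddSubgroup.closure_le N).mpr ?_ hm
  rintro _ ⟨γ, rfl⟩
  exact h γ

theorem eq_zero_of_proj_eq_zero {m : M} (h : ∀ γ, Mod.proj γ m = 0) : m = 0 :=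
  (AddSubgroup.mem_bot).mp (Mod.mem_of_proj_mem fun γ => (AddSubgroup.mem_bot).mpr (h γ))

@[elab_as_elim]
theorem grade_induction {p : M → Prop} (m : M) (mem : ∀ γ, ∀ m ∈ Mod.grade γ, p m) (zero : p 0)
    (add : ∀ m n, p m → p n → p (m + n)) : p m :=
  AddSubgroup.iSup_induction Mod.grade (C := p) (Mod.grade_iSup ▸ AddSubgroup.mem_top m) mem zero add

variable {Mod} in
theorem IsGradedSub.proj_mem {N : AddSubgroup M} (hN : Mod.IsGradedSub N) (γ : Γ) {m : M}
    (hm : m ∈ N) : Mod.proj γ m ∈ N := by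
  classical
  refine AddSubgroup.iSup_induction _ (C := fun m => Mod.proj γ m ∈ N) (hN.2 hm)
    (fun δ m hm => ?_) (by simp) fun m n hm hn => ?_
  · by_cases h : γ = δ
    · subst h
      rw [Mod.proj_of_mem hm.1]
      exact hm.2
    · rw [Mod.proj_of_mem_ne h hm.1]
      exact N.zero_mem
  · rw [map_add]
    exact N.add_mem hm hn

theorem proj_smul {σ τ : Γ} (h : G.src σ = G.tgt τ) {m : M} (hm : m ∈ Mod.grade σ) (a : R) :
    Mod.proj (G.comp σ τ h) (Mod.smul m a) = Mod.smul m (RG.regular.proj τ a) := by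
  induction a using RG.regular.grade_induction with
  | mem δ a ha =>
    by_cases hd : τ = δ
    · subst hd
      rw [RG.regular.proj_of_mem ha, Mod.proj_of_mem (Mod.smul_mem σ τ h m a hm ha)]
    · rw [RG.regular.proj_of_mem_ne hd ha, Mod.smul_zero]
      by_cases h' : G.src σ = G.tgt δ
      · exact Mod.proj_of_mem_ne (fun e => hd (G.comp_left_cancel σ τ δ h h' e))
          (Mod.smul_mem σ δ h' m a hm ha)
      · rw [Mod.smul_ne σ δ h' m a hm ha, map_zero]
  | zero => simp [Mod.smul_zero]
  | add a b ha hb => simp only [Mod.smul_add, map_add, ha, hb]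

/-- The components of `1_e a` vanish outside of the degrees with target `e`. -/
theorem _root_.GammaRing.proj_one_mul_of_ne {e τ : Γ} (he : G.IsObj e) (h : G.tgt τ ≠ e) (a : R) :
    RG.regular.proj τ (RG.one e * a) = 0 := by
  induction a using RG.regular.grade_induction with
  | mem δ a ha =>
    by_cases hd : e = G.tgt δ
    · subst hd
      rw [RG.one_mul' δ a ha]
      exact RG.regular.proj_of_mem_ne (fun e => h (e ▸ rfl)) ha
    · rw [RG.mul_ne e δ (by rwa [he]) _ a (RG.one_mem e he) ha, map_zero]
  | zero => simp
  | add a b ha hb => rw [mul_add, map_add, ha, hb, add_zero]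

theorem smul_one_mul {σ : Γ} {m : M} (hm : m ∈ Mod.grade σ) (a : R) :
    Mod.smul m (RG.one (G.src σ) * a) = Mod.smul m a := by
  rw [Mod.smul_mul, Mod.smul_one σ m hm]

theorem _root_.GammaRing.one_mul_one {e : Γ} (he : G.IsObj e) :
    RG.one e * RG.one e = RG.one e := by
  have h := RG.mul_one' e (RG.one e) (RG.one_mem e he)
  rwa [he] at h

/-- The graded submodule generated by a set of homogeneous elements. -/
def gspan (S : Set M) : AddSubgroup M :=
  AddSubgroup.closure {m : M | ∃ s ∈ S, ∃ r : R, m = Mod.smul s r}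

/-- `m` is homogeneous of some degree. -/
def IsHomog (m : M) : Prop := ∃ γ, m ∈ Mod.grade γ

theorem smul_mem_gspan {S : Set M} {s : M} (hs : s ∈ S) (r : R) : Mod.smul s r ∈ Mod.gspan S :=
  AddSubgroup.subset_closure ⟨s, hs, r, rfl⟩

theorem subset_gspan {S : Set M} (hS : ∀ s ∈ S, Mod.IsHomog s) {s : M} (hs : s ∈ S) :
    s ∈ Mod.gspan S := by
  obtain ⟨γ, hγ⟩ := hS s hs
  rw [← Mod.smul_one γ s hγ]
  exact Mod.smul_mem_gspan hs _

theorem gspan_mono {S T : Set M} (h : S ⊆ T) : Mod.gspan S ≤ Mod.gspan T :=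
  AddSubgroup.closure_mono fun _ ⟨s, hs, r, e⟩ => ⟨s, h hs, r, e⟩

theorem gspan_smul_mem (S : Set M) {m : M} (hm : m ∈ Mod.gspan S) (a : R) :
    Mod.smul m a ∈ Mod.gspan S := by
  induction hm using AddSubgroup.closure_induction with
  | mem m hm =>
    obtain ⟨s, hs, r, rfl⟩ := hm
    rw [← Mod.smul_mul]
    exact Mod.smul_mem_gspan hs _
  | zero => rw [Mod.zero_smul]; exact AddSubgroup.zero_mem _
  | add m n _ _ hm hn => rw [Mod.add_smul]; exact AddSubgroup.add_mem _ hm hn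
  | neg m _ hm => rw [Mod.neg_smul]; exact AddSubgroup.neg_mem _ hm

theorem gspan_le {S : Set M} {N : AddSubgroup M} (hN : ∀ m ∈ N, ∀ a : R, Mod.smul m a ∈ N)
    (h : S ⊆ N) : Mod.gspan S ≤ N := by
  rw [gspan, AddSubgroup.closure_le]
  rintro _ ⟨s, hs, r, rfl⟩
  exact hN s (h hs) r

theorem isGradedSub_gspan {S : Set M} (hS : ∀ s ∈ S, Mod.IsHomog s) :
    Mod.IsGradedSub (Mod.gspan S) := by
  refine ⟨fun m hm a => Mod.gspan_smul_mem S hm a, ?_⟩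
  conv_lhs => rw [gspan]
  rw [AddSubgroup.closure_le]
  rintro _ ⟨s, hs, r, rfl⟩
  obtain ⟨γ, hγ⟩ := hS s hs
  simp only [SetLike.mem_coe]
  induction r using RG.regular.grade_induction with
  | mem δ a ha =>
    by_cases h : G.src γ = G.tgt δ
    · exact AddSubgroup.mem_iSup_of_mem (G.comp γ δ h)
        ⟨Mod.smul_mem γ δ h s a hγ ha, Mod.smul_mem_gspan hs a⟩
    · rw [Mod.smul_ne γ δ h s a hγ ha]
      exact AddSubgroup.zero_mem _
  | zero => rw [Mod.smul_zero]; exact AddSubgroup.zero_mem _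
  | add a b ha hb => rw [Mod.smul_add]; exact AddSubgroup.add_mem _ ha hb

theorem exists_finite_subset_mem_gspan {S : Set M} {m : M} (hm : m ∈ Mod.gspan S) :
    ∃ T ⊆ S, T.Finite ∧ m ∈ Mod.gspan T := by
  induction hm using AddSubgroup.closure_induction with
  | mem m hm =>
    obtain ⟨s, hs, r, rfl⟩ := hm
    exact ⟨{s}, Set.singleton_subset_iff.mpr hs, Set.finite_singleton s,
      Mod.smul_mem_gspan (Set.mem_singleton s) r⟩
  | zero => exact ⟨∅, Set.empty_subset _, Set.finite_empty, AddSubgroup.zero_mem _⟩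
  | add m n _ _ hm hn =>
    obtain ⟨T, hT, hTf, hm⟩ := hm
    obtain ⟨U, hU, hUf, hn⟩ := hn
    exact ⟨T ∪ U, Set.union_subset hT hU, hTf.union hUf, AddSubgroup.add_mem _
      (Mod.gspan_mono Set.subset_union_left hm) (Mod.gspan_mono Set.subset_union_right hn)⟩
  | neg m _ hm =>
    obtain ⟨T, hT, hTf, hm⟩ := hm
    exact ⟨T, hT, hTf, AddSubgroup.neg_mem _ hm⟩

theorem exists_sub_smul_mem_gspan {S : Set M} {m x : M} (hx : x ∈ Mod.gspan (insert m S)) :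
    ∃ a : R, x - Mod.smul m a ∈ Mod.gspan S := by
  induction hx using AddSubgroup.closure_induction with
  | mem x hx =>
    obtain ⟨s, rfl | hs, r, rfl⟩ := hx
    · exact ⟨r, by rw [sub_self]; exact AddSubgroup.zero_mem _⟩
    · exact ⟨0, by rw [Mod.smul_zero, sub_zero]; exact Mod.smul_mem_gspan hs r⟩
  | zero => exact ⟨0, by rw [Mod.smul_zero, sub_zero]; exact AddSubgroup.zero_mem _⟩
  | add x y _ _ hx hy =>
    obtain ⟨a, ha⟩ := hx
    obtain ⟨b, hb⟩ := hy
    refine ⟨a + b, ?_⟩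
    rw [Mod.smul_add, add_sub_add_comm]
    exact AddSubgroup.add_mem _ ha hb
  | neg x _ hx =>
    obtain ⟨a, ha⟩ := hx
    refine ⟨-a, ?_⟩
    rw [Mod.smul_neg, neg_sub_neg, ← neg_sub]
    exact AddSubgroup.neg_mem _ ha

end GammaMod

namespace GammaMod

variable {Γ : Type u} {G : Gpd Γ} {R : Type v} [NonUnitalRing R] {RG : GammaRing G R}
  {M : Type w} [AddCommGroup M] (Mod : GammaMod RG M)

/-- A set of homogeneous elements none of which lies in the graded submodule generated by
the other ones. -/
def Indep (S : Set M) : Prop :=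
  (∀ s ∈ S, Mod.IsHomog s) ∧ ∀ s ∈ S, s ∉ Mod.gspan (S \ {s})

theorem Indep.mono {Mod : GammaMod RG M} {S T : Set M} (hT : Mod.Indep T) (h : S ⊆ T) :
    Mod.Indep S :=
  ⟨fun s hs => hT.1 s (h hs), fun s hs hs' =>
    hT.2 s (h hs) (Mod.gspan_mono (Set.sdiff_subset_sdiff_left h) hs')⟩

section PseudoBases

variable {ι : Type y} {β : ι → Γ} {v : ι → M}

theorem exists_finsupp_of_mem_gspan_image (hv : ∀ i, v i ∈ Mod.grade (β i)) (J : Set ι) {m : M}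
    (hm : m ∈ Mod.gspan (v '' J)) :
    ∃ a : ι →₀ R, (∀ i, RG.one (G.src (β i)) * a i = a i) ∧ (∀ i ∉ J, a i = 0) ∧
      (a.sum fun i r => Mod.smul (v i) r) = m := by
  classical
  induction hm using AddSubgroup.closure_induction with
  | mem m hm =>
    obtain ⟨_, ⟨i, hi, rfl⟩, r, rfl⟩ := hm
    refine ⟨Finsupp.single i (RG.one (G.src (β i)) * r), fun j => ?_, fun j hj => ?_, ?_⟩
    · by_cases h : j = i
      · subst h
        rw [Finsupp.single_eq_same, ← mul_assoc, RG.one_mul_one (G.src_src _)]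
      · rw [Finsupp.single_eq_of_ne h, mul_zero]
    · exact Finsupp.single_eq_of_ne fun h => hj (h ▸ hi)
    · rw [Finsupp.sum_single_index (h := fun i r => Mod.smul (v i) r) (Mod.smul_zero _), Mod.smul_one_mul (hv i)]
  | zero => exact ⟨0, by simp, by simp, by simp⟩
  | add m n _ _ hm hn =>
    obtain ⟨a, ha, haJ, rfl⟩ := hm
    obtain ⟨b, hb, hbJ, rfl⟩ := hn
    refine ⟨a + b, fun i => ?_, fun i hi => ?_, ?_⟩
    · rw [Finsupp.add_apply, mul_add, ha, hb]
    · rw [Finsupp.add_apply, haJ i hi, hbJ i hi, add_zero]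
    · exact Finsupp.sum_add_index' (fun i => Mod.smul_zero _) fun i => Mod.smul_add _
  | neg m _ hm =>
    obtain ⟨a, ha, haJ, rfl⟩ := hm
    refine ⟨-a, fun i => ?_, fun i hi => ?_, ?_⟩
    · rw [Finsupp.neg_apply, mul_neg, ha]
    · rw [Finsupp.neg_apply, haJ i hi, neg_zero]
    · rw [Finsupp.sum_neg_index (h := fun i r => Mod.smul (v i) r) fun i => Mod.smul_zero _]
      simp only [Mod.smul_neg, Finsupp.sum, Finset.sum_neg_distrib]

theorem gspan_range_eq_top_iff :
    Mod.gspan (Set.range v) = ⊤ ↔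
      AddSubgroup.closure {m : M | ∃ (i : ι) (r : R), m = Mod.smul (v i) r} = ⊤ := by
  simp only [gspan, Set.exists_range_iff]

variable {Mod}

theorem PseudoLI.notMem_gspan (h : Mod.PseudoLI β v) (i : ι) : v i ∉ Mod.gspan (v '' {i}ᶜ) := by
  classical
  intro hi
  obtain ⟨a, ha, haJ, hsum⟩ := Mod.exists_finsupp_of_mem_gspan_image (fun i => (h.1 i).1) _ hi
  have key := h.2 (a - Finsupp.single i (RG.one (G.src (β i)))) (fun j => ?_) ?_
  · have := DFunLike.congr_fun key i
    rw [Finsupp.sub_apply, Finsupp.single_eq_same, haJ i (by simp), Finsupp.zero_apply, zero_sub,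
      neg_eq_zero] at this
    apply (h.1 i).2
    rw [← Mod.smul_one _ _ (h.1 i).1, this, Mod.smul_zero]
  · rw [Finsupp.sub_apply, mul_sub, ha]
    by_cases hj : j = i
    · subst hj
      rw [Finsupp.single_eq_same, RG.one_mul_one (G.src_src _)]
    · rw [Finsupp.single_eq_of_ne hj, mul_zero]
  · rw [Finsupp.sum_sub_index (h := fun i r => Mod.smul (v i) r) fun i => map_sub (Mod.smulHom (v i)),
      Finsupp.sum_single_index (h := fun i r => Mod.smul (v i) r) (Mod.smul_zero _), hsum, Mod.smul_one _ _ (h.1 i).1, sub_self]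

theorem PseudoLI.injective (h : Mod.PseudoLI β v) : Function.Injective v := by
  intro i j hij
  by_contra hne
  refine h.notMem_gspan i (Mod.subset_gspan ?_ ⟨j, fun h => hne h.symm, hij.symm⟩)
  rintro _ ⟨k, -, rfl⟩
  exact ⟨_, (h.1 k).1⟩

theorem PseudoLI.indep (h : Mod.PseudoLI β v) : Mod.Indep (Set.range v) := by
  refine ⟨?_, ?_⟩
  · rintro _ ⟨i, rfl⟩
    exact ⟨_, (h.1 i).1⟩
  · rintro _ ⟨i, rfl⟩ hi
    refine h.notMem_gspan i (Mod.gspan_mono ?_ hi)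
    rintro _ ⟨⟨j, rfl⟩, hj⟩
    exact ⟨j, fun e => hj (e ▸ rfl), rfl⟩

/-- A pseudo-basis of a module generated by finitely many homogeneous elements is finite. -/
theorem PseudoBasis.finite_index (h : Mod.PseudoBasis β v) {T : Set M} (hT : T.Finite)
    (hTtop : Mod.gspan T = ⊤) : Finite ι := by
  classical
  have htop := Mod.gspan_range_eq_top_iff.mpr h.2
  have hfin : ∀ t : M, ∃ J : Set ι, J.Finite ∧ t ∈ Mod.gspan (v '' J) := by
    intro t
    obtain ⟨U, hU, hUf, ht⟩ :=
      Mod.exists_finite_subset_mem_gspan (htop ▸ AddSubgroup.mem_top t : t ∈ Mod.gspan (Set.range v))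
    exact ⟨v ⁻¹' U, hUf.preimage h.1.injective.injOn, by
      rwa [Set.image_preimage_eq_of_subset hU]⟩
  choose J hJ hmem using hfin
  have hall : Mod.gspan (v '' ⋃ t ∈ T, J t) = ⊤ := by
    rw [eq_top_iff, ← hTtop]
    exact Mod.gspan_le (fun m hm a => Mod.gspan_smul_mem _ hm a) fun t ht =>
      Mod.gspan_mono (Set.image_mono (Set.subset_biUnion_of_mem ht)) (hmem t)
  refine Set.finite_univ_iff.mp ((hT.biUnion fun t _ => hJ t).subset fun i _ => ?_)
  by_contra hi
  refine h.1.notMem_gspan i (Mod.gspan_mono (Set.image_mono ?_) (hall ▸ AddSubgroup.mem_top (v i)))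
  rintro j hj rfl
  exact hi hj

theorem PseudoBasis.reindex {κ : Type x} (h : Mod.PseudoBasis β v) (e : κ ≃ ι) :
    Mod.PseudoBasis (β ∘ e) (v ∘ e) := by
  refine ⟨⟨fun i => h.1.1 (e i), fun a ha hsum => ?_⟩, ?_⟩
  · have := h.1.2 (Finsupp.equivMapDomain e a) (fun i => ?_) ?_
    · ext i
      have hi := DFunLike.congr_fun this (e i)
      simpa using hi
    · have := ha (e.symm i)
      simpa using this
    · rw [Finsupp.sum_equivMapDomain]
      exact hsum
  · rw [← gspan_range_eq_top_iff, Set.range_comp, e.surjective.range_eq, Set.image_univ,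
      gspan_range_eq_top_iff]
    exact h.2

end PseudoBases

section Division

variable {Mod}

theorem mem_of_smul_mem (hD : RG.IsGrDivision) {N : AddSubgroup M} (hN : Mod.IsGradedSub N)
    {σ : Γ} {m : M} (hm : m ∈ Mod.grade σ) {a : R} (ha : Mod.smul m a ∈ N)
    (h0 : RG.one (G.src σ) * a ≠ 0) : m ∈ N := by
  obtain ⟨τ, hτ⟩ : ∃ τ, RG.regular.proj τ (RG.one (G.src σ) * a) ≠ 0 := by
    by_contra! h
    exact h0 (RG.regular.eq_zero_of_proj_eq_zero h)
  have hστ : G.tgt τ = G.src σ := by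
    by_contra h
    exact hτ (RG.proj_one_mul_of_ne (G.src_src σ) h a)
  obtain ⟨b, -, hb, -⟩ := hD.2 τ _ (RG.regular.proj_mem τ _) hτ
  have hmem := hN.1 _ (hN.proj_mem (G.comp σ τ hστ.symm) ha) b
  rwa [← Mod.smul_one_mul hm a, Mod.proj_smul hστ.symm hm, ← Mod.smul_mul, hb, hστ,
    Mod.smul_one σ m hm] at hmem

theorem gspan_exchange (hD : RG.IsGrDivision) {S : Set M} {m x : M}
    (hS : ∀ s ∈ S, Mod.IsHomog s) (hm : Mod.IsHomog m) (hx : Mod.IsHomog x)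
    (h : x ∈ Mod.gspan (insert m S)) (h' : x ∉ Mod.gspan S) : m ∈ Mod.gspan (insert x S) := by
  obtain ⟨a, ha⟩ := Mod.exists_sub_smul_mem_gspan h
  obtain ⟨σ, hσ⟩ := hm
  have hS' : ∀ s ∈ insert x S, Mod.IsHomog s := by
    rintro s (rfl | hs)
    exacts [hx, hS s hs]
  refine mem_of_smul_mem hD (Mod.isGradedSub_gspan hS') hσ (a := a) ?_ fun h0 => h' ?_
  · rw [← sub_sub_cancel x (Mod.smul m a)]
    exact AddSubgroup.sub_mem _ (Mod.subset_gspan hS' (Set.mem_insert x S))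
      (Mod.gspan_mono (Set.subset_insert x S) ha)
  · rwa [← Mod.smul_one_mul hσ, h0, Mod.smul_zero, sub_zero] at ha

theorem Indep.insert_of_notMem (hD : RG.IsGrDivision) {S : Set M} (hS : Mod.Indep S) {m : M}
    (hm : Mod.IsHomog m) (h : m ∉ Mod.gspan S) : Mod.Indep (insert m S) := by
  refine ⟨?_, ?_⟩
  · rintro s (rfl | hs)
    exacts [hm, hS.1 s hs]
  · rintro s (rfl | hs) hs'
    · exact h (Mod.gspan_mono (by simp) hs')
    · refine h (Mod.gspan_mono (Set.insert_subset hs Set.sdiff_subset) (gspan_exchange hD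
        (fun t ht => hS.1 t ht.1) hm (hS.1 s hs) (Mod.gspan_mono ?_ hs') (hS.2 s hs)))
      rintro t ⟨rfl | ht, hts⟩
      exacts [Set.mem_insert _ _, Set.mem_insert_of_mem _ ⟨ht, hts⟩]

/-- Steinitz exchange: independent sets are no larger than generating sets. -/
theorem Indep.card_le (hD : RG.IsGrDivision) [DecidableEq M] {T : Finset M}
    (hT : ∀ t ∈ T, Mod.IsHomog t) (htop : Mod.gspan (T : Set M) = ⊤) {I : Finset M}
    (hI : Mod.Indep (I : Set M)) : I.card ≤ T.card := by
  induction hn : (I \ T).card generalizing I with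
  | zero =>
    rw [Finset.card_eq_zero, Finset.sdiff_eq_empty_iff_subset] at hn
    exact Finset.card_le_card hn
  | succ n ih =>
    obtain ⟨x, hx⟩ : (I \ T).Nonempty := Finset.card_pos.mp (by omega)
    obtain ⟨hxI, hxT⟩ := Finset.mem_sdiff.mp hx
    have hx' := hI.2 x hxI
    obtain ⟨t, htT, ht⟩ : ∃ t ∈ T, t ∉ Mod.gspan ((I : Set M) \ {x}) := by
      by_contra! h
      refine hx' ?_
      have := Mod.gspan_le (S := T) (fun m hm a => Mod.gspan_smul_mem _ hm a) h
      exact this (htop ▸ AddSubgroup.mem_top x)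
    have hind : Mod.Indep ((insert t (I.erase x) : Finset M) : Set M) := by
      rw [Finset.coe_insert, Finset.coe_erase]
      exact (hI.mono Set.sdiff_subset).insert_of_notMem hD (hT t htT) ht
    have htI : t ∉ I.erase x := fun h => ht <| Mod.subset_gspan
      (fun s hs => hI.1 s hs.1) (by simpa [and_comm] using h)
    have hcard := Finset.card_erase_add_one hxI
    have hsd : insert t (I.erase x) \ T = (I \ T).erase x := by
      ext s
      simp only [Finset.mem_sdiff, Finset.mem_insert, Finset.mem_erase]
      constructor
      · rintro ⟨rfl | h, hs⟩
        exacts [absurd htT hs, ⟨h.1, h.2, hs⟩]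
      · rintro ⟨h, hs, hs'⟩
        exact ⟨Or.inr ⟨h, hs⟩, hs'⟩
    have := ih hind (by rw [hsd, Finset.card_erase_of_mem hx, hn, Nat.add_sub_cancel])
    rw [Finset.card_insert_of_notMem htI] at this
    omega

theorem PseudoLI.le_of_pseudoBasis (hD : RG.IsGrDivision) {m n : ℕ} {β₁ : Fin m → Γ}
    {v₁ : Fin m → M} {β₂ : Fin n → Γ} {v₂ : Fin n → M} (h₁ : Mod.PseudoLI β₁ v₁)
    (h₂ : Mod.PseudoBasis β₂ v₂) : m ≤ n := by
  classical
  have hle := Indep.card_le (Mod := Mod) hD (I := Finset.univ.image v₁) (T := Finset.univ.image v₂)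
    (by simpa using fun i => ⟨_, (h₂.1.1 i).1⟩)
    (by simpa using Mod.gspan_range_eq_top_iff.mpr h₂.2) (by simpa using h₁.indep)
  rwa [Finset.card_image_of_injective _ h₁.injective, Finset.card_image_of_injective _
    h₂.1.injective, Finset.card_univ, Finset.card_univ, Fintype.card_fin, Fintype.card_fin] at hle

theorem Indep.pseudoLI (hD : RG.IsGrDivision) {ι : Type y} {β : ι → Γ} {v : ι → M}
    (hv : ∀ i, v i ∈ Mod.grade (β i)) (hinj : Function.Injective v)
    (h : Mod.Indep (Set.range v)) : Mod.PseudoLI β v := by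
  classical
  refine ⟨fun i => ⟨hv i, fun h0 => h.2 (v i) ⟨i, rfl⟩ (h0 ▸ AddSubgroup.zero_mem _)⟩,
    fun a ha hsum => ?_⟩
  ext i
  by_contra hi
  refine h.2 (v i) ⟨i, rfl⟩ (mem_of_smul_mem hD
    (Mod.isGradedSub_gspan fun s hs => h.1 s hs.1) (hv i) (a := a i) ?_ (by rwa [ha]))
  rw [Finsupp.sum, ← Finset.add_sum_erase _ _ (Finsupp.mem_support_iff.mpr hi)] at hsum
  rw [eq_neg_of_add_eq_zero_left hsum]
  refine AddSubgroup.neg_mem _ (AddSubgroup.sum_mem _ fun j hj => Mod.smul_mem_gspan ?_ _)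
  exact ⟨⟨j, rfl⟩, fun e => (Finset.mem_erase.mp hj).1 (hinj e)⟩

theorem exists_indep_gspan_eq_top (hD : RG.IsGrDivision) :
    ∃ S : Set M, Mod.Indep S ∧ Mod.gspan S = ⊤ := by
  have hfc : Order.IsOfFiniteCharacter {S : Set M | Mod.Indep S} := by
    refine fun S => ⟨fun hS T hT _ => hS.mono hT, fun h => ⟨fun s hs => ?_, fun s hs hs' => ?_⟩⟩
    · exact (h {s} (by simpa using hs) (Set.finite_singleton s)).1 s rfl
    · obtain ⟨T, hT, hTf, hsT⟩ := Mod.exists_finite_subset_mem_gspan hs'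
      have hi := h (insert s T) (Set.insert_subset hs (hT.trans Set.sdiff_subset)) (hTf.insert s)
      have hsub : T ⊆ insert s T \ {s} := fun t ht => ⟨Or.inr ht, (hT ht).2⟩
      exact hi.2 s (Set.mem_insert s T) (Mod.gspan_mono hsub hsT)
  obtain ⟨S, -, hS⟩ := hfc.exists_maximal (x := ∅) (show Mod.Indep ∅ from ⟨by simp, by simp⟩)
  refine ⟨S, hS.1, (AddSubgroup.eq_top_iff' _).mpr fun m => ?_⟩
  induction m using Mod.grade_induction with
  | mem γ m hm =>
    by_contra h
    exact h (Mod.subset_gspan hS.1.1 (hS.2 (hS.1.insert_of_notMem hD ⟨γ, hm⟩ h)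
      (Set.subset_insert m S) (Set.mem_insert m S)))
  | zero => exact AddSubgroup.zero_mem _
  | add m n hm hn => exact AddSubgroup.add_mem _ hm hn

theorem pseudoFree_of_isGrDivision (hD : RG.IsGrDivision) : Mod.PseudoFree := by
  obtain ⟨S, hS, htop⟩ := Mod.exists_indep_gspan_eq_top hD
  have hr : Set.range (fun s : ULift.{u} S => (s.down : M)) = S := by
    ext m
    simp
  refine ⟨ULift.{u} S, fun s => (hS.1 s.down s.down.2).choose, fun s => s.down, ?_, ?_⟩
  · exact Indep.pseudoLI hD (fun s => (hS.1 s.down s.down.2).choose_spec)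
      (Subtype.val_injective.comp ULift.down_injective) (hr.symm ▸ hS)
  · rw [← gspan_range_eq_top_iff, hr, htop]

end Division

end GammaMod

namespace GammaMod

variable {Γ : Type u} {G : Gpd Γ} {R : Type v} [NonUnitalRing R] {RG : GammaRing G R}
  {M : Type w} [AddCommGroup M] {Mod : GammaMod RG M} {N : AddSubgroup M}

/-- A graded submodule, as a graded module. -/
def sub (hN : Mod.IsGradedSub N) : GammaMod RG N where
  smul n a := ⟨Mod.smul n a, hN.1 n n.2 a⟩
  smul_add m a b := Subtype.ext (Mod.smul_add m a b)
  add_smul m n a := Subtype.ext (Mod.add_smul m n a)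
  smul_mul m a b := Subtype.ext (Mod.smul_mul m a b)
  grade γ := (Mod.grade γ).addSubgroupOf N
  grade_iSup := by
    refine AddSubgroup.map_injective N.subtype_injective ?_
    rw [AddSubgroup.map_iSup, ← AddMonoidHom.range_eq_map, AddSubgroup.range_subtype]
    simp only [AddSubgroup.addSubgroupOf_map_subtype]
    exact le_antisymm (iSup_le fun γ => inf_le_right) hN.2
  grade_indep γ := by
    refine (AddSubgroup.eq_bot_iff_forall _).mpr fun x hx => Subtype.ext ?_
    have h : (x : M) ∈ Mod.grade γ ⊓ ⨆ (δ : Γ) (_ : δ ≠ γ), Mod.grade δ := by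
      refine ⟨hx.1, ?_⟩
      have hx' := AddSubgroup.mem_map_of_mem N.subtype hx.2
      simp only [AddSubgroup.map_iSup, AddSubgroup.addSubgroupOf_map_subtype] at hx'
      have hle : (⨆ (δ : Γ) (_ : δ ≠ γ), Mod.grade δ ⊓ N) ≤
          ⨆ (δ : Γ) (_ : δ ≠ γ), Mod.grade δ := iSup₂_mono fun δ _ => inf_le_left
      exact hle hx'
    rw [Mod.grade_indep γ] at h
    exact AddSubgroup.mem_bot.mp h
  smul_mem σ τ h m a hm ha := Mod.smul_mem σ τ h m a hm ha
  smul_ne σ τ h m a hm ha := Subtype.ext (Mod.smul_ne σ τ h m a hm ha)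
  smul_one σ m hm := Subtype.ext (Mod.smul_one σ m hm)

/-- The quotient of a graded module by a graded submodule. -/
def quotient (hN : Mod.IsGradedSub N) : GammaMod RG (M ⧸ N) where
  smul m a := QuotientAddGroup.map N N (Mod.smulHom.flip a) (fun n hn => hN.1 n hn a) m
  smul_add m a b := by
    induction m using QuotientAddGroup.induction_on with
    | H m => exact congrArg (QuotientAddGroup.mk' N) (Mod.smul_add m a b)
  add_smul m n a := map_add _ m n
  smul_mul m a b := by
    induction m using QuotientAddGroup.induction_on with
    | H m => exact congrArg (QuotientAddGroup.mk' N) (Mod.smul_mul m a b)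
  grade γ := (Mod.grade γ).map (QuotientAddGroup.mk' N)
  grade_iSup := by
    rw [← AddSubgroup.map_iSup, Mod.grade_iSup,
      AddSubgroup.map_top_of_surjective _ (QuotientAddGroup.mk'_surjective N)]
  grade_indep γ := by
    refine (AddSubgroup.eq_bot_iff_forall _).mpr ?_
    rintro _ ⟨⟨m, hm, rfl⟩, hx⟩
    simp only [← AddSubgroup.map_iSup] at hx
    obtain ⟨n, hn, hnm⟩ := hx
    have hsub : n - m ∈ N := (QuotientAddGroup.eq_iff_sub_mem).mp hnm
    have hzero : Mod.proj γ n = 0 := by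
      have hle : (⨆ (δ : Γ) (_ : δ ≠ γ), Mod.grade δ) ≤ (Mod.proj γ).ker :=
        iSup₂_le fun δ hδ x hx => Mod.proj_of_mem_ne hδ.symm hx
      exact hle hn
    have h := hN.proj_mem γ hsub
    rw [map_sub, hzero, Mod.proj_of_mem hm, zero_sub, neg_mem_iff] at h
    exact (QuotientAddGroup.eq_zero_iff m).mpr h
  smul_mem := by
    rintro σ τ h _ a ⟨m, hm, rfl⟩ ha
    exact ⟨Mod.smul m a, Mod.smul_mem σ τ h m a hm ha, rfl⟩
  smul_ne := by
    rintro σ τ h _ a ⟨m, hm, rfl⟩ ha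
    exact congrArg (QuotientAddGroup.mk' N) (Mod.smul_ne σ τ h m a hm ha)
  smul_one := by
    rintro σ _ ⟨m, hm, rfl⟩
    exact congrArg (QuotientAddGroup.mk' N) (Mod.smul_one σ m hm)

/-- Pseudo-bases of a graded submodule and of the quotient combine to a pseudo-basis. -/
theorem PseudoBasis.exists_extension (hN : Mod.IsGradedSub N) {ι : Type x} {κ : Type y}
    {β : ι → Γ} {v : ι → N} (hv : (sub hN).PseudoBasis β v)
    {β' : κ → Γ} {v' : κ → M ⧸ N} (hv' : (quotient hN).PseudoBasis β' v') :
    ∃ (β'' : ι ⊕ κ → Γ) (v'' : ι ⊕ κ → M), Mod.PseudoBasis β'' v'' := by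
  have hlift : ∀ j, ∃ m ∈ Mod.grade (β' j), QuotientAddGroup.mk' N m = v' j := fun j =>
    (hv'.1.1 j).1
  choose m hm hmv using hlift
  refine ⟨Sum.elim β β', Sum.elim (fun i => (v i : M)) m, ⟨?_, ?_⟩, ?_⟩
  · rintro (i | j)
    · exact ⟨(hv.1.1 i).1, fun h => (hv.1.1 i).2 (Subtype.ext h)⟩
    · refine ⟨hm j, fun h => (hv'.1.1 j).2 ?_⟩
      rw [← hmv j]
      exact (congrArg (QuotientAddGroup.mk' N) h).trans (map_zero _)
  · intro a ha hsum
    obtain ⟨f, g, rfl⟩ : ∃ (f : ι →₀ R) (g : κ →₀ R), a = Finsupp.sumElim f g :=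
      ⟨_, _, (Finsupp.comapDomain_sumElim_comapDomain a).symm⟩
    rw [Finsupp.sum_sumElim] at hsum
    have hf : ∀ i, RG.one (G.src (β i)) * f i = f i := fun i => ha (Sum.inl i)
    have hg : ∀ j, RG.one (G.src (β' j)) * g j = g j := fun j => ha (Sum.inr j)
    have hfN : (f.sum fun i r => Mod.smul (v i) r) ∈ N :=
      AddSubgroup.sum_mem _ fun i _ => hN.1 _ (v i).2 _
    have hg0 : g = 0 := by
      refine hv'.1.2 g hg ?_
      have h := congrArg (QuotientAddGroup.mk' N) hsum
      have hf0 : QuotientAddGroup.mk' N (f.sum fun i r => Mod.smul (v i) r) = 0 :=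
        (QuotientAddGroup.eq_zero_iff _).mpr hfN
      rw [map_add, map_zero] at h
      erw [hf0, zero_add, map_finsuppSum] at h
      rw [← h]
      refine Finset.sum_congr rfl fun j _ => ?_
      simp only [← hmv]
      rfl
    subst hg0
    have hf0 : f = 0 := by
      refine hv.1.2 f hf (Subtype.ext ?_)
      rw [Finsupp.sum_zero_index, add_zero] at hsum
      refine Eq.trans ?_ hsum
      exact map_finsuppSum N.subtype f _
    rw [hf0, Finsupp.sumElim_zero_zero]
  · set C := AddSubgroup.closure {x : M | ∃ (i : ι ⊕ κ) (r : R),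
      x = Mod.smul (Sum.elim (fun i => (v i : M)) m i) r} with hC
    have hNC : N ≤ C := by
      have h := congrArg (AddSubgroup.map N.subtype) hv.2
      rw [← AddMonoidHom.range_eq_map, AddSubgroup.range_subtype, AddMonoidHom.map_closure] at h
      rw [← h]
      refine AddSubgroup.closure_mono ?_
      rintro _ ⟨_, ⟨i, r, rfl⟩, rfl⟩
      exact ⟨Sum.inl i, r, rfl⟩
    have hQ : C.map (QuotientAddGroup.mk' N) = ⊤ := by
      rw [eq_top_iff, ← hv'.2, AddSubgroup.closure_le]
      rintro _ ⟨j, r, rfl⟩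
      refine ⟨Mod.smul (m j) r, AddSubgroup.subset_closure ⟨Sum.inr j, r, rfl⟩, ?_⟩
      rw [← hmv]
      rfl
    refine (AddSubgroup.eq_top_iff' C).mpr fun x => ?_
    obtain ⟨c, hc, hcx⟩ : QuotientAddGroup.mk' N x ∈ C.map (QuotientAddGroup.mk' N) :=
      hQ ▸ AddSubgroup.mem_top _
    have hsub : c - x ∈ N := (QuotientAddGroup.eq_iff_sub_mem).mp hcx
    rw [← sub_sub_cancel c x]
    exact C.sub_mem hc (hNC hsub)

theorem gspan_sub_coe_preimage {S : Set M} (hS : ∀ s ∈ S, Mod.IsHomog s) :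
    (sub (Mod.isGradedSub_gspan hS)).gspan (Subtype.val ⁻¹' S) = ⊤ := by
  refine Eq.trans ?_ (AddSubgroup.closure_closure_coe_preimage
    (k := {m : M | ∃ s ∈ S, ∃ r : R, m = Mod.smul s r}))
  refine congrArg AddSubgroup.closure (Set.ext fun x => ⟨?_, ?_⟩)
  · rintro ⟨s, hs, r, rfl⟩
    exact ⟨s, hs, r, rfl⟩
  · rintro ⟨s, hs, r, h⟩
    exact ⟨⟨s, Mod.subset_gspan hS hs⟩, hs, r, Subtype.ext h⟩

theorem mem_gspan_singleton {s m : M} : m ∈ Mod.gspan {s} ↔ ∃ r, m = Mod.smul s r := by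
  refine ⟨fun h => ?_, ?_⟩
  · obtain ⟨r, hr⟩ := Mod.exists_sub_smul_mem_gspan (S := ∅) (by simpa using h)
    refine ⟨r, sub_eq_zero.mp ?_⟩
    simpa [gspan] using hr
  · rintro ⟨r, rfl⟩
    exact Mod.smul_mem_gspan (Set.mem_singleton s) r

end GammaMod

namespace GammaRing

variable {Γ : Type u} {G : Gpd Γ} {R : Type v} [NonUnitalRing R] {RG : GammaRing G R}

theorem isHomog_one {e : Γ} (he : G.IsObj e) : ∀ s ∈ ({RG.one e} : Set R), RG.regular.IsHomog s :=
  fun _ hs => ⟨e, hs ▸ RG.one_mem e he⟩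

/-- The cyclic graded right module `1_e R`. -/
def oneMod (RG : GammaRing G R) {e : Γ} (he : G.IsObj e) :
    GammaMod RG (RG.regular.gspan {RG.one e}) :=
  GammaMod.sub (RG.regular.isGradedSub_gspan (isHomog_one he))

theorem one_mem_gspan {e : Γ} (he : G.IsObj e) : RG.one e ∈ RG.regular.gspan {RG.one e} :=
  RG.regular.subset_gspan (isHomog_one he) rfl

theorem oneMod_gspan_eq_top {e : Γ} (he : G.IsObj e) :
    (RG.oneMod he).gspan {⟨RG.one e, one_mem_gspan he⟩} = ⊤ := by
  rw [← GammaMod.gspan_sub_coe_preimage (isHomog_one he)]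
  refine congrArg _ (Set.ext fun x => ?_)
  simp [Subtype.ext_iff]

theorem oneMod_pseudoBasis {e : Γ} (he : G.IsObj e) (h : RG.one e ≠ 0) :
    (RG.oneMod he).PseudoBasis (fun _ : Fin 1 => e) fun _ => ⟨RG.one e, one_mem_gspan he⟩ := by
  refine ⟨⟨fun _ => ⟨RG.one_mem e he, fun h0 => h (congrArg Subtype.val h0)⟩,
    fun a ha hsum => ?_⟩, ?_⟩
  · refine Finsupp.ext fun i => ?_
    obtain rfl := Subsingleton.elim i 0
    have h0 : RG.one e * a 0 = 0 := by
      rw [Finsupp.sum_fintype _ _ fun _ => GammaMod.smul_zero _ _, Fin.sum_univ_one] at hsum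
      exact congrArg Subtype.val hsum
    have h1 := ha 0
    rw [he] at h1
    rw [← h1, h0, Finsupp.zero_apply]
  · rw [← GammaMod.gspan_range_eq_top_iff, Set.range_const, oneMod_gspan_eq_top]

/-- Over a pfm ring with IPBN, nonzero homogeneous elements are right invertible. -/
theorem exists_right_inverse (hpfm : GammaRing.IsPfm.{u, v, v} RG)
    (hipbn : GammaRing.IPBN.{u, v, v} RG) {γ : Γ} {a : R} (ha : a ∈ RG.grade γ) (h0 : a ≠ 0) :
    ∃ b ∈ RG.grade (G.inv γ), a * b = RG.one (G.tgt γ) := by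
  have he : G.IsObj (G.tgt γ) := G.src_tgt γ
  have h1 : RG.one (G.tgt γ) ≠ 0 := fun h => h0 (by rw [← RG.one_mul' γ a ha, h, zero_mul])
  let Mod := RG.oneMod he
  let a' : RG.regular.gspan {RG.one (G.tgt γ)} :=
    ⟨a, GammaMod.mem_gspan_singleton.mpr ⟨a, (RG.one_mul' γ a ha).symm⟩⟩
  have ha' : ∀ s ∈ ({a'} : Set _), Mod.IsHomog s := fun s hs => ⟨γ, by
    obtain rfl := hs
    exact ha⟩
  have hN := Mod.isGradedSub_gspan ha'
  obtain ⟨ι, β, v, hv⟩ := hpfm ⟨_, GammaMod.sub hN⟩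
  obtain ⟨κ, β', v', hv'⟩ := hpfm ⟨_, GammaMod.quotient hN⟩
  obtain ⟨β'', v'', hv''⟩ := GammaMod.PseudoBasis.exists_extension hN hv hv'
  have hfin : Finite (ι ⊕ κ) :=
    hv''.finite_index (Set.finite_singleton _) (oneMod_gspan_eq_top he)
  obtain ⟨n, ⟨f⟩⟩ := Finite.exists_equiv_fin (ι ⊕ κ)
  obtain rfl : n = 1 := hipbn ⟨_, Mod⟩ n 1 _ _ _ _ (hv''.reindex f.symm)
    (oneMod_pseudoBasis he h1)
  have hι : Nonempty ι := by
    by_contra hι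
    rw [not_nonempty_iff] at hι
    have htop := hv.2
    simp only [IsEmpty.exists_iff, Set.ofPred_false, AddSubgroup.closure_empty] at htop
    have hmem : (⟨a', Mod.subset_gspan ha' rfl⟩ : Mod.gspan {a'}) ∈ (⊥ : AddSubgroup _) :=
      htop ▸ AddSubgroup.mem_top _
    exact h0 (congrArg (fun x => x.1.1) (AddSubgroup.mem_bot.mp hmem))
  have hκ : IsEmpty κ := by
    obtain ⟨i⟩ := hι
    refine ⟨fun j => ?_⟩
    have := f.injective (Subsingleton.elim (f (Sum.inl i)) (f (Sum.inr j)))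
    cases this
  have hQ := hv'.2
  simp only [IsEmpty.exists_iff, Set.ofPred_false, AddSubgroup.closure_empty] at hQ
  have hmem : (⟨RG.one (G.tgt γ), one_mem_gspan he⟩ : RG.regular.gspan {RG.one (G.tgt γ)}) ∈
      Mod.gspan {a'} := by
    rw [← QuotientAddGroup.eq_zero_iff, ← AddSubgroup.mem_bot]
    exact hQ ▸ AddSubgroup.mem_top _
  obtain ⟨r, hr⟩ := GammaMod.mem_gspan_singleton.mp hmem
  have hr' : RG.one (G.tgt γ) = a * r := congrArg Subtype.val hr
  refine ⟨RG.regular.proj (G.inv γ) r, RG.regular.proj_mem _ _, ?_⟩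
  have hp := RG.regular.proj_smul (G.tgt_inv γ).symm ha r
  rw [G.comp_inv] at hp
  refine Eq.trans hp.symm ?_
  change RG.regular.proj _ (a * r) = _
  rw [← hr']
  exact RG.regular.proj_of_mem (RG.one_mem _ he)

theorem isGrDivision_of_isPfm_of_ipbn (hR : ∃ a : R, a ≠ 0)
    (hpfm : GammaRing.IsPfm.{u, v, v} RG) (hipbn : GammaRing.IPBN.{u, v, v} RG) :
    RG.IsGrDivision := by
  refine ⟨hR, fun γ a ha h0 => ?_⟩
  obtain ⟨b, hb, hab⟩ := exists_right_inverse hpfm hipbn ha h0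
  have hb0 : b ≠ 0 := by
    rintro rfl
    rw [mul_zero] at hab
    exact h0 (by rw [← RG.one_mul' γ a ha, ← hab, zero_mul])
  obtain ⟨c, hc, hbc⟩ := exists_right_inverse hpfm hipbn hb hb0
  rw [G.inv_inv] at hc
  rw [G.tgt_inv] at hbc
  have hca : c = a := by
    rw [← RG.one_mul' γ c hc, ← hab, mul_assoc, hbc, RG.mul_one' γ a ha]
  exact ⟨b, hb, hab, hca ▸ hbc⟩

end GammaRing

/-- A (nonzero) object unital `Γ`-graded ring `R` is a
`Γ`-graded division ring if and only if `R` is a pfm ring (every `Γ`-graded right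
`R`-module is pseudo-free) having invariant pseudo-basis number (any two
pseudo-bases of a finitely generated pseudo-free graded right `R`-module have the
same number of elements). -/
theorem graded_division_iff_pfm_and_IPBN
    {Γ : Type u} (G : Gpd Γ) {R : Type v} [NonUnitalRing R] (RG : GammaRing G R)
    (hR : ∃ a : R, a ≠ 0) :
    RG.IsGrDivision ↔
      (GammaRing.IsPfm.{u, v, v} RG ∧ GammaRing.IPBN.{u, v, v} RG) :=
  ⟨fun hD => ⟨fun _ => GammaMod.pseudoFree_of_isGrDivision hD, fun _ _ _ _ _ _ _ h₁ h₂ =>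
    le_antisymm (h₁.1.le_of_pseudoBasis hD h₂) (h₂.1.le_of_pseudoBasis hD h₁)⟩,
    fun h => GammaRing.isGrDivision_of_isPfm_of_ipbn hR h.1 h.2⟩
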